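/- arXiv:2302.13710 — 4 statements merged into one kernel-verified Lean document; each statement's English description precedes it below -/
import Mathlib

section
/- (Lemma 3, policy dominance) Let y ∈ ℝ and let d̃* ∈ D be optimal for the pseudo problem at y. If a policy d ∈ D satisfies μ^d ∈ [y − |y − μ^{d̃*}|, y + |y − μ^{d̃*}|] (equivalently |μ^d − y| ≤ |μ^{d̃*} − y|), then β·σ^{d̃*} − μ^{d̃*} ≤ β·σ^d − μ^d, i.e. η^{d̃*} ≤ η^d. -/
open Finset

/-- The steady-state mean `μ = ∑ i, π i * r i` of a reward vector `r` under a
probability vector `π`. -/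
def mdpMean {S : Type*} [Fintype S] (π r : S → ℝ) : ℝ := ∑ i, π i * r i

/-- The steady-state variance `σ = ∑ i, π i * (r i - μ)²`. -/
def mdpVar {S : Type*} [Fintype S] (π r : S → ℝ) : ℝ :=
  ∑ i, π i * (r i - mdpMean π r)^2

/-- The pseudo variance `σ̃(y) = ∑ i, π i * (r i - y)²` with pseudo mean `y`. -/
def mdpPseudoVar {S : Type*} [Fintype S] (π r : S → ℝ) (y : ℝ) : ℝ :=
  ∑ i, π i * (r i - y)^2

/-- The mean-variance objective `η = β·σ - μ`. -/
def mdpEta {S : Type*} [Fintype S] (π r : S → ℝ) (β : ℝ) : ℝ :=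
  β * mdpVar π r - mdpMean π r

/-- The pseudo mean-variance objective `η̃(y) = β·σ̃(y) - μ`. -/
def mdpPseudoEta {S : Type*} [Fintype S] (π r : S → ℝ) (β y : ℝ) : ℝ :=
  β * mdpPseudoVar π r y - mdpMean π r

/-- The optimal pseudo mean-variance objective `η̃*(y) = min_{d ∈ D} η̃^d(y)`. -/
def mdpPseudoEtaStar {S D : Type*} [Fintype S] [Fintype D] [Nonempty D]
    (π r : D → S → ℝ) (β y : ℝ) : ℝ :=
  Finset.univ.inf' Finset.univ_nonempty (fun d => mdpPseudoEta (π d) (r d) β y)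

/-- The pseudo variance exceeds the variance by the squared distance of the mean to `y`. -/
theorem mdpPseudoVar_eq_mdpVar_add_sq {S : Type*} [Fintype S] {π : S → ℝ}
    (hsum : ∑ i, π i = 1) (r : S → ℝ) (y : ℝ) :
    mdpPseudoVar π r y = mdpVar π r + (mdpMean π r - y) ^ 2 := by
  have key (c : ℝ) :
      ∑ i, π i * (r i - c) ^ 2 = ∑ i, π i * r i ^ 2 - 2 * c * mdpMean π r + c ^ 2 := by
    have expand (i : S) :
        π i * (r i - c) ^ 2 = π i * r i ^ 2 - 2 * c * (π i * r i) + c ^ 2 * π i := by ring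
    simp only [expand, sum_add_distrib, sum_sub_distrib, ← mul_sum, hsum, mdpMean, mul_one]
  rw [mdpPseudoVar, mdpVar, key, key]
  ring

/-- Lemma 3 (policy dominance): if `d̃*` is optimal for the pseudo problem at `y` and
`μ^d ∈ [y - |y - μ^{d̃*}|, y + |y - μ^{d̃*}|]`, then `β·σ^{d̃*} - μ^{d̃*} ≤ β·σ^d - μ^d`. -/
theorem policy_dominance {S D : Type*} [Fintype S] [Nonempty S]
    [Fintype D] [Nonempty D]
    (π r : D → S → ℝ)
    (hπ : ∀ d i, 0 ≤ π d i) (hπsum : ∀ d, ∑ i, π d i = 1)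
    (β : ℝ) (hβ : 0 ≤ β)
    (y : ℝ) (dtil : D)
    (hopt : mdpPseudoEta (π dtil) (r dtil) β y = mdpPseudoEtaStar π r β y)
    (d : D)
    (hmem : mdpMean (π d) (r d) ∈
      Set.Icc (y - |y - mdpMean (π dtil) (r dtil)|)
              (y + |y - mdpMean (π dtil) (r dtil)|)) :
    β * mdpVar (π dtil) (r dtil) - mdpMean (π dtil) (r dtil)
      ≤ β * mdpVar (π d) (r d) - mdpMean (π d) (r d) := by
  have hle : mdpPseudoEta (π dtil) (r dtil) β y ≤ mdpPseudoEta (π d) (r d) β y :=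
    hopt.trans_le (Finset.inf'_le _ (mem_univ d))
  simp only [mdpPseudoEta, mdpPseudoVar_eq_mdpVar_add_sq (hπsum _)] at hle
  have hsq : (mdpMean (π d) (r d) - y) ^ 2 ≤ (mdpMean (π dtil) (r dtil) - y) ^ 2 := by
    rw [sq_le_sq, abs_le, abs_sub_comm (mdpMean (π dtil) (r dtil))]
    constructor <;> linarith [hmem.1, hmem.2]
  linarith [mul_le_mul_of_nonneg_left hsq hβ]
end

section
/- (Optimality regions are intervals) For every policy d ∈ D, the set { y ∈ ℝ : η̃^d(y) = η̃*(y) } of pseudo means at which d is optimal for the pseudo problem is a convex subset of ℝ (i.e. an interval). -/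
open Finset

/-- The pseudo objective is a quadratic in `y` with leading coefficient `β` for every policy. -/
lemma mdpPseudoEta_eq {S : Type*} [Fintype S] (π r : S → ℝ) (hπ : ∑ i, π i = 1) (β y : ℝ) :
    mdpPseudoEta π r β y =
      β * y ^ 2 + (-2 * β * mdpMean π r) * y + (β * ∑ i, π i * r i ^ 2 - mdpMean π r) := by
  have h : mdpPseudoVar π r y = (∑ i, π i * r i ^ 2) - 2 * y * mdpMean π r + y ^ 2 := by
    calc mdpPseudoVar π r y
        = ∑ i, (π i * r i ^ 2 - 2 * y * (π i * r i) + π i * y ^ 2) :=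
          Finset.sum_congr rfl fun i _ => by ring
      _ = (∑ i, π i * r i ^ 2) - 2 * y * mdpMean π r + y ^ 2 := by
          rw [Finset.sum_add_distrib, Finset.sum_sub_distrib, ← Finset.mul_sum,
            ← Finset.sum_mul, hπ, one_mul, mdpMean]
  rw [mdpPseudoEta, h]
  ring

/-- A policy is optimal at `y` iff no other policy has a smaller pseudo objective there. -/
lemma mdpPseudoEta_eq_star_iff {S D : Type*} [Fintype S] [Fintype D] [Nonempty D]
    (π r : D → S → ℝ) (β y : ℝ) (d : D) :
    mdpPseudoEta (π d) (r d) β y = mdpPseudoEtaStar π r β y ↔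
      ∀ e, mdpPseudoEta (π d) (r d) β y ≤ mdpPseudoEta (π e) (r e) β y := by
  have h : mdpPseudoEtaStar π r β y ≤ mdpPseudoEta (π d) (r d) β y :=
    Finset.inf'_le (fun d => mdpPseudoEta (π d) (r d) β y) (Finset.mem_univ d)
  rw [← h.ge_iff_eq', mdpPseudoEtaStar, Finset.le_inf'_iff]
  simp

/-- Optimality regions are intervals: for every policy `d`, the set of pseudo means `y`
at which `d` is optimal for the pseudo problem is a convex subset of `ℝ`. -/
theorem optimality_region_convex {S D : Type*} [Fintype S] [Nonempty S]
    [Fintype D] [Nonempty D]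
    (π r : D → S → ℝ)
    (hπ : ∀ d i, 0 ≤ π d i) (hπsum : ∀ d, ∑ i, π d i = 1)
    (β : ℝ) (hβ : 0 ≤ β) :
    ∀ d : D,
      Convex ℝ {y : ℝ | mdpPseudoEta (π d) (r d) β y = mdpPseudoEtaStar π r β y} := by
  intro d x hx y hy a b ha hb hab
  simp only [Set.mem_ofPred_eq, mdpPseudoEta_eq_star_iff, smul_eq_mul] at hx hy ⊢
  intro e
  have h₁ := mul_le_mul_of_nonneg_left (hx e) ha
  have h₂ := mul_le_mul_of_nonneg_left (hy e) hb
  simp only [mdpPseudoEta_eq _ _ (hπsum _)] at h₁ h₂ ⊢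
  obtain rfl : b = 1 - a := by linarith
  linarith
end

section
/- (Monotonicity of optimal means in the pseudo mean) Suppose β > 0. Let y₁ < y₂ be real numbers, let d₁ ∈ D be optimal for the pseudo problem at y₁ and let d₂ ∈ D be optimal for the pseudo problem at y₂. Then μ^{d₁} ≤ μ^{d₂}. -/
open Finset

/-- Expansion of the pseudo variance in the pseudo mean. -/
theorem mdpPseudoVar_eq {S : Type*} [Fintype S] (π r : S → ℝ) (hπ : ∑ i, π i = 1) (y : ℝ) :
    mdpPseudoVar π r y = ∑ i, π i * r i ^ 2 - 2 * y * mdpMean π r + y ^ 2 := by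
  calc mdpPseudoVar π r y
      = ∑ i, (π i * r i ^ 2 - 2 * y * (π i * r i) + y ^ 2 * π i) :=
        Finset.sum_congr rfl fun i _ => by ring
    _ = _ := by
        rw [Finset.sum_add_distrib, Finset.sum_sub_distrib, ← Finset.mul_sum, ← Finset.mul_sum,
          hπ, mul_one, mdpMean]

/-- The optimal pseudo objective is a lower bound for the pseudo objective of every policy. -/
theorem mdpPseudoEtaStar_le {S D : Type*} [Fintype S] [Fintype D] [Nonempty D]
    (π r : D → S → ℝ) (β y : ℝ) (d : D) :
    mdpPseudoEtaStar π r β y ≤ mdpPseudoEta (π d) (r d) β y :=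
  Finset.inf'_le _ (Finset.mem_univ d)

/-- Monotonicity of optimal means in the pseudo mean: if `β > 0`, `y₁ < y₂`, `d₁` is
optimal for the pseudo problem at `y₁` and `d₂` is optimal at `y₂`, then `μ^{d₁} ≤ μ^{d₂}`. -/
theorem optimal_means_monotone {S D : Type*} [Fintype S] [Nonempty S]
    [Fintype D] [Nonempty D]
    (π r : D → S → ℝ)
    (hπ : ∀ d i, 0 ≤ π d i) (hπsum : ∀ d, ∑ i, π d i = 1)
    (β : ℝ) (hβ : 0 < β)
    (y₁ y₂ : ℝ) (hy : y₁ < y₂) (d₁ d₂ : D)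
    (hopt₁ : mdpPseudoEta (π d₁) (r d₁) β y₁ = mdpPseudoEtaStar π r β y₁)
    (hopt₂ : mdpPseudoEta (π d₂) (r d₂) β y₂ = mdpPseudoEtaStar π r β y₂) :
    mdpMean (π d₁) (r d₁) ≤ mdpMean (π d₂) (r d₂) := by
  have h₁ := hopt₁.trans_le (mdpPseudoEtaStar_le π r β y₁ d₂)
  have h₂ := hopt₂.trans_le (mdpPseudoEtaStar_le π r β y₂ d₁)
  simp only [mdpPseudoEta, mdpPseudoVar_eq _ _ (hπsum _)] at h₁ h₂
  have hpos : 0 < β * (y₂ - y₁) := mul_pos hβ (sub_pos.mpr hy)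
  refine le_of_mul_le_mul_left ?_ hpos
  linarith
end

section
/- (Structure of the optimal pseudo objective) The function y ↦ η̃*(y) − β·y² is concave on ℝ, and the function y ↦ η̃*(y) is continuous on ℝ. Moreover, for every y ∈ ℝ, η̃*(y) = min_{d ∈ D} ( η^d + β·(y − μ^d)² ), so η̃* is the pointwise minimum of finitely many quadratic functions with common leading coefficient β. -/
open Finset

/-- The pseudo variance exceeds the variance by the squared distance of `y` to the mean. -/
theorem mdpPseudoVar_eq_mdpVar_add {S : Type*} [Fintype S] {π : S → ℝ} (r : S → ℝ)
    (hπ : ∑ i, π i = 1) (y : ℝ) :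
    mdpPseudoVar π r y = mdpVar π r + (y - mdpMean π r) ^ 2 := by
  have expand (c : ℝ) :
      ∑ i, π i * (r i - c) ^ 2 = ∑ i, π i * r i ^ 2 - 2 * c * mdpMean π r + c ^ 2 := by
    calc ∑ i, π i * (r i - c) ^ 2
        = ∑ i, (π i * r i ^ 2 - 2 * c * (π i * r i) + c ^ 2 * π i) :=
          Finset.sum_congr rfl fun i _ => by ring
      _ = _ := by
          rw [Finset.sum_add_distrib, Finset.sum_sub_distrib, ← Finset.mul_sum,
            ← Finset.mul_sum, hπ, mdpMean, mul_one]
  rw [mdpPseudoVar, mdpVar, expand, expand]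
  ring

theorem mdpPseudoEta_eq_mdpEta_add {S : Type*} [Fintype S] {π : S → ℝ} (r : S → ℝ)
    (hπ : ∑ i, π i = 1) (β y : ℝ) :
    mdpPseudoEta π r β y = mdpEta π r β + β * (y - mdpMean π r) ^ 2 := by
  rw [mdpPseudoEta, mdpEta, mdpPseudoVar_eq_mdpVar_add r hπ]
  ring

/-- Structure of the optimal pseudo objective: `y ↦ η̃*(y) - β·y²` is concave on `ℝ`,
`y ↦ η̃*(y)` is continuous, and `η̃*(y) = min_{d ∈ D} (η^d + β·(y - μ^d)²)` for all `y`,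
i.e. `η̃*` is the pointwise minimum of finitely many quadratics with leading coefficient `β`. -/
theorem pseudoEtaStar_structure {S D : Type*} [Fintype S] [Nonempty S]
    [Fintype D] [Nonempty D]
    (π r : D → S → ℝ)
    (hπ : ∀ d i, 0 ≤ π d i) (hπsum : ∀ d, ∑ i, π d i = 1)
    (β : ℝ) (hβ : 0 ≤ β) :
    ConcaveOn ℝ Set.univ (fun y : ℝ => mdpPseudoEtaStar π r β y - β * y^2) ∧
    Continuous (fun y : ℝ => mdpPseudoEtaStar π r β y) ∧
    (∀ y : ℝ,
      mdpPseudoEtaStar π r β y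
        = Finset.univ.inf' Finset.univ_nonempty
            (fun d : D => mdpEta (π d) (r d) β + β * (y - mdpMean (π d) (r d))^2)) := by
  have star_eq (y : ℝ) : mdpPseudoEtaStar π r β y = Finset.univ.inf' Finset.univ_nonempty
      (fun d : D => mdpEta (π d) (r d) β + β * (y - mdpMean (π d) (r d)) ^ 2) := by
    simp only [mdpPseudoEtaStar, mdpPseudoEta_eq_mdpEta_add _ (hπsum _)]
  refine ⟨⟨convex_univ, fun x _ y _ a b ha hb hab => ?_⟩, ?_, star_eq⟩
  · obtain ⟨d, -, hd⟩ := Finset.exists_mem_eq_inf' (Finset.univ_nonempty (α := D))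
      (fun d => mdpEta (π d) (r d) β + β * (a * x + b * y - mdpMean (π d) (r d)) ^ 2)
    have le (z : ℝ) : mdpPseudoEtaStar π r β z ≤
        mdpEta (π d) (r d) β + β * (z - mdpMean (π d) (r d)) ^ 2 := by
      rw [star_eq]
      exact Finset.inf'_le _ (Finset.mem_univ d)
    have hx := mul_le_mul_of_nonneg_left (le x) ha
    have hy := mul_le_mul_of_nonneg_left (le y) hb
    simp only [smul_eq_mul]
    rw [star_eq (a * x + b * y), hd]
    obtain rfl : b = 1 - a := by linarith
    linarith
  · simp only [star_eq]
    exact Continuous.finset_inf'_apply _ fun d _ => by fun_prop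
end
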